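/- Let φ(s) = ∑_{n≥1} c_n n^{−s} be a non-constant Dirichlet series that converges uniformly on ℂ_ε for every ε > 0 and satisfies φ(ℂ₀) ⊂ ℂ_{1/2}, and suppose the composition operator C_φ is bounded and compact on ℋ². Then there exist a constant c > 0 and a number r ∈ (0,1) such that a_n(C_φ) ≥ c·rⁿ for every n ≥ 1. -/

import Mathlib

open Complex Filter MeasureTheory

noncomputable section

/-- The Hilbert space `ℋ²` of Dirichlet series with square-summable coefficients,
modeled by its coefficient sequences (indexed by `ℕ+`). -/
abbrev H2 := ↥(lp (fun _ : ℕ+ => ℂ) 2)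

/-- The Dirichlet series attached to an element of `ℋ²`; it converges on `Re s > 1/2`. -/
noncomputable def H2series (x : H2) (s : ℂ) : ℂ := ∑' n : ℕ+, x n * (n : ℂ) ^ (-s)

/-- `T` is (the bounded operator realizing) the composition operator `C_φ` on `ℋ²`:
for every `f ∈ ℋ²`, the Dirichlet series of `T f` agrees with `f ∘ φ` on `ℂ_{1/2}`. -/
def IsCompOp (φ : ℂ → ℂ) (T : H2 →L[ℂ] H2) : Prop :=
  ∀ (x : H2) (s : ℂ), 1 / 2 < s.re → H2series (T x) s = H2series x (φ s)

/-- The `n`-th approximation number of a bounded operator: the distance in operator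
norm to the operators of rank `< n`. -/
noncomputable def approxNumber {E F : Type*} [NormedAddCommGroup E] [NormedSpace ℂ E]
    [NormedAddCommGroup F] [NormedSpace ℂ F] (T : E →L[ℂ] F) (n : ℕ) : ℝ :=
  sInf {c : ℝ | ∃ R : E →L[ℂ] F,
    FiniteDimensional ℂ (LinearMap.range (R : E →ₗ[ℂ] F)) ∧
    Module.finrank ℂ (LinearMap.range (R : E →ₗ[ℂ] F)) < n ∧ c = ‖T - R‖}

/-- The Dirichlet series with coefficients `c` converges uniformly on `ℂ_ε = {Re s > ε}`
for every `ε > 0`, with sum `φ`. -/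
def DSConvUnif (c : ℕ → ℂ) (φ : ℂ → ℂ) : Prop :=
  ∀ ε : ℝ, 0 < ε →
    TendstoUniformlyOn (fun N s => ∑ n ∈ Finset.range N, LSeries.term c s n) φ
      atTop {s : ℂ | ε < s.re}

/-- **Cauchy's estimate** for the coefficients of a polynomial. -/
theorem Polynomial.norm_coeff_le_of_sphere (p : Polynomial ℂ) {R M : ℝ} (hR : 0 < R)
    (hM : ∀ z : ℂ, ‖z‖ = R → ‖p.eval z‖ ≤ M) (j : ℕ) : ‖p.coeff j‖ ≤ M / R ^ j := by
  have hder : ∀ m : ℕ, iteratedDeriv m (fun z => p.eval z) =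
      fun z => (Polynomial.derivative^[m] p).eval z := by
    intro m
    induction m with
    | zero => simp
    | succ m ih =>
      rw [iteratedDeriv_succ, ih, Function.iterate_succ_apply']
      funext z
      exact Polynomial.deriv _
  have h := norm_iteratedDeriv_le_of_forall_mem_sphere_norm_le (c := 0) (f := fun z => p.eval z)
    j hR p.differentiable.diffContOnCl (fun z hz => hM z (by simpa using hz))
  rw [hder] at h
  have hc : (Polynomial.derivative^[j] p).eval 0 = (j.factorial : ℂ) * p.coeff j := by
    rw [← Polynomial.coeff_zero_eq_eval_zero, Polynomial.coeff_iterate_derivative]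
    simp [Nat.descFactorial_self]
  simp only [hc, norm_mul, Complex.norm_natCast] at h
  have hj : (0 : ℝ) < j.factorial := by exact_mod_cast j.factorial_pos
  rw [mul_div_assoc] at h
  exact le_of_mul_le_mul_left h hj

/-- An inequality of Bernstein–Walsh type: the coefficients of a polynomial of degree `< n` are
controlled by its size on an arbitrary small disc with centre in the closed unit disc. -/
theorem Polynomial.sum_norm_coeff_le_of_closedBall (p : Polynomial ℂ) {n : ℕ}
    (hn : p.natDegree < n) {z₀ : ℂ} (hz₀ : ‖z₀‖ ≤ 1) {ρ M : ℝ} (hρ : 0 < ρ) (hρ1 : ρ ≤ 1)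
    (hM : ∀ z : ℂ, ‖z - z₀‖ ≤ ρ → ‖p.eval z‖ ≤ M) :
    ∑ k ∈ Finset.range n, ‖p.coeff k‖ ≤ M * (8 / ρ) ^ n := by
  have hM0 : 0 ≤ M := (norm_nonneg _).trans (hM z₀ (by simpa using hρ.le))
  have hcoeff : ∀ j, ‖(Polynomial.taylor z₀ p).coeff j‖ ≤ M / ρ ^ j :=
    Polynomial.norm_coeff_le_of_sphere _ hρ fun z hz => by
      rw [Polynomial.taylor_eval]
      exact hM _ (by simp [hz])
  have h2ρ : 1 ≤ 2 / ρ := by rw [le_div_iff₀ hρ]; linarith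
  have hunit : ∀ z : ℂ, ‖z‖ = 1 → ‖p.eval z‖ ≤ n * (M * (2 / ρ) ^ n) := by
    intro z hz
    have hz2 : ‖z - z₀‖ ≤ 2 := (norm_sub_le _ _).trans (by linarith)
    have hev : p.eval z = (Polynomial.taylor z₀ p).eval (z - z₀) := by
      rw [Polynomial.taylor_eval, sub_add_cancel]
    rw [hev, Polynomial.eval_eq_sum_range' (n := n) (by rwa [Polynomial.natDegree_taylor])]
    refine (norm_sum_le_of_le (Finset.range n) (n := fun _ => M * (2 / ρ) ^ n) ?_).trans ?_
    · intro j hj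
      rw [norm_mul, norm_pow]
      calc ‖(Polynomial.taylor z₀ p).coeff j‖ * ‖z - z₀‖ ^ j ≤ M / ρ ^ j * 2 ^ j := by
            gcongr
            exact hcoeff j
        _ = M * (2 / ρ) ^ j := by rw [div_pow]; ring
        _ ≤ M * (2 / ρ) ^ n := by
            gcongr
            exact (Finset.mem_range.mp hj).le
    · simp
  have hn2 : (n : ℝ) ≤ 2 ^ n := by exact_mod_cast Nat.lt_two_pow_self.le
  calc ∑ k ∈ Finset.range n, ‖p.coeff k‖
      ≤ ∑ k ∈ Finset.range n, n * (M * (2 / ρ) ^ n) :=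
        Finset.sum_le_sum fun k _ => by
          simpa using Polynomial.norm_coeff_le_of_sphere p one_pos hunit k
    _ = n * (n * (M * (2 / ρ) ^ n)) := by simp
    _ ≤ 2 ^ n * (2 ^ n * (M * (2 / ρ) ^ n)) := by gcongr
    _ = M * (8 / ρ) ^ n := by
        rw [show (8 : ℝ) / ρ = 2 * (2 * (2 / ρ)) by ring, mul_pow, mul_pow]
        ring

/-- If `T` is bounded below by `δ` on the range of an injective linear map from an
`n`-dimensional space, then `δ` is a lower bound for the `n`-th approximation number of `T`. -/
theorem le_approxNumber {E F : Type*} [NormedAddCommGroup E] [NormedSpace ℂ E]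
    [NormedAddCommGroup F] [NormedSpace ℂ F] (T : E →L[ℂ] F) {n : ℕ} (hn : 1 ≤ n)
    (L : (Fin n → ℂ) →ₗ[ℂ] E) {δ : ℝ} (hL : ∀ a, a ≠ 0 → L a ≠ 0)
    (hT : ∀ a, δ * ‖L a‖ ≤ ‖T (L a)‖) : δ ≤ approxNumber T n := by
  refine le_csInf ⟨_, 0, ?_, ?_, rfl⟩ ?_
  · rw [ContinuousLinearMap.toLinearMap_zero, LinearMap.range_zero]
    infer_instance
  · rw [ContinuousLinearMap.toLinearMap_zero, LinearMap.range_zero, finrank_bot]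
    omega
  · rintro _ ⟨R, hfin, hrank, rfl⟩
    have hker : LinearMap.ker ((R : E →ₗ[ℂ] F).rangeRestrict ∘ₗ L) ≠ ⊥ :=
      LinearMap.ker_ne_bot_of_finrank_lt (by simpa using hrank)
    obtain ⟨a, ha, ha0⟩ := (Submodule.ne_bot_iff _).mp hker
    have hRa : R (L a) = 0 := by
      simpa [Subtype.ext_iff] using ha
    have hpos : 0 < ‖L a‖ := norm_pos_iff.mpr (hL a ha0)
    refine le_of_mul_le_mul_right ?_ hpos
    calc δ * ‖L a‖ ≤ ‖T (L a)‖ := hT a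
      _ = ‖(T - R) (L a)‖ := by simp [hRa]
      _ ≤ ‖T - R‖ * ‖L a‖ := (T - R).le_opNorm _

/-- The Dirichlet series `∑ₖ aₖ 2^{-ks}`, as an element of `ℋ²`. -/
def dyadicH2 (n : ℕ) : (Fin n → ℂ) →ₗ[ℂ] H2 :=
  Fintype.linearCombination ℂ fun k : Fin n => lp.single 2 ((2 : ℕ+) ^ (k : ℕ)) (1 : ℂ)

/-- The polynomial `∑ₖ aₖ zᵏ`. -/
def coeffPoly {n : ℕ} (a : Fin n → ℂ) : Polynomial ℂ :=
  ∑ k : Fin n, Polynomial.C (a k) * Polynomial.X ^ (k : ℕ)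

theorem natDegree_coeffPoly_lt {n : ℕ} (hn : 1 ≤ n) (a : Fin n → ℂ) :
    (coeffPoly a).natDegree < n := by
  have h : (coeffPoly a).natDegree ≤ n - 1 :=
    Polynomial.natDegree_sum_le_of_forall_le _ _ fun k _ =>
      (Polynomial.natDegree_C_mul_X_pow_le _ _).trans (by omega)
  omega

theorem coeff_coeffPoly {n : ℕ} (a : Fin n → ℂ) (k : Fin n) : (coeffPoly a).coeff k = a k := by
  simp [coeffPoly, Polynomial.finsetSum_coeff, Polynomial.coeff_X_pow, Fin.val_inj]

theorem norm_dyadicH2_le {n : ℕ} (a : Fin n → ℂ) : ‖dyadicH2 n a‖ ≤ ∑ k, ‖a k‖ := by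
  rw [dyadicH2, Fintype.linearCombination_apply]
  refine norm_sum_le_of_le _ fun k _ => ?_
  rw [norm_smul, lp.norm_single (by norm_num)]
  simp

theorem H2series_dyadicH2 {n : ℕ} (a : Fin n → ℂ) (s : ℂ) :
    H2series (dyadicH2 n a) s = (coeffPoly a).eval ((2 : ℂ) ^ (-s)) := by
  have h : ∀ k : Fin n, HasSum
      (fun m : ℕ+ => a k * (lp.single 2 ((2 : ℕ+) ^ (k : ℕ)) (1 : ℂ) : H2) m * (m : ℂ) ^ (-s))
      (a k * ((2 : ℂ) ^ (-s)) ^ (k : ℕ)) := by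
    intro k
    convert hasSum_single ((2 : ℕ+) ^ (k : ℕ)) ?_ using 1
    · rw [lp.single_apply_self, mul_one, PNat.pow_coe, Nat.cast_pow, ← Complex.natCast_cpow_natCast_mul,
        Complex.cpow_nat_mul]
      simp
    · intro m hm
      rw [lp.single_apply_ne _ _ _ hm]
      simp
  have hs := hasSum_sum (s := Finset.univ) fun k _ => h k
  rw [H2series, coeffPoly, Polynomial.eval_finsetSum]
  simp only [Polynomial.eval_mul, Polynomial.eval_C, Polynomial.eval_pow, Polynomial.eval_X]
  rw [← hs.tsum_eq]
  refine tsum_congr fun m => ?_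
  rw [← Finset.sum_mul, dyadicH2, Fintype.linearCombination_apply, lp.coeFn_sum, Finset.sum_apply]
  rfl

theorem dyadicH2_ne_zero {n : ℕ} (a : Fin n → ℂ) (ha : a ≠ 0) : dyadicH2 n a ≠ 0 := by
  obtain ⟨k, hk⟩ := Function.ne_iff.mp ha
  intro h0
  refine hk ?_
  have h1 : (dyadicH2 n a) ((2 : ℕ+) ^ (k : ℕ)) = 0 := by rw [h0]; rfl
  rw [dyadicH2, Fintype.linearCombination_apply, lp.coeFn_sum, Finset.sum_apply,
    Finset.sum_eq_single k] at h1
  · simpa using h1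
  · intro j _ hj
    have hne : (2 : ℕ+) ^ (k : ℕ) ≠ 2 ^ (j : ℕ) := fun h => hj (by
      have h2 := congrArg PNat.val h
      simp only [PNat.pow_coe] at h2
      exact Fin.ext (Nat.pow_right_injective le_rfl h2.symm))
    rw [lp.coeFn_smul, Pi.smul_apply, lp.single_apply_ne _ _ _ hne, smul_zero]
  · simp

/-- Point evaluations on `ℂ₂` are uniformly bounded on `ℋ²`. -/
theorem exists_norm_H2series_le :
    ∃ A : ℝ, 0 < A ∧ ∀ (y : H2) (s : ℂ), 2 < s.re → ‖H2series y s‖ ≤ A * ‖y‖ := by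
  have hsum : Summable fun m : ℕ+ => (1 : ℝ) / (m : ℝ) ^ 2 :=
    (Real.summable_one_div_nat_pow.mpr one_lt_two).comp_injective PNat.coe_injective
  refine ⟨_, hsum.tsum_pos (fun m => by positivity) 1 (by simp), fun y s hs => ?_⟩
  refine tsum_of_norm_bounded (hsum.hasSum.mul_right ‖y‖) fun m => ?_
  have hm : (1 : ℝ) ≤ (m : ℕ) := by exact_mod_cast m.pos
  have hpow : ‖((m : ℕ) : ℂ) ^ (-s)‖ ≤ 1 / ((m : ℕ) : ℝ) ^ 2 := by
    rw [Complex.norm_natCast_cpow_of_pos m.pos, Complex.neg_re, Real.rpow_neg (by positivity),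
      one_div, ← Real.rpow_two]
    gcongr
  rw [norm_mul, mul_comm]
  gcongr
  exact lp.norm_apply_le_norm two_ne_zero y m

theorem DSConvUnif.differentiableOn {c : ℕ → ℂ} {φ : ℂ → ℂ} (h : DSConvUnif c φ) :
    DifferentiableOn ℂ φ {s : ℂ | 0 < s.re} := by
  intro s hs
  have hs : 0 < s.re := hs
  have hopen : IsOpen {z : ℂ | s.re / 2 < z.re} := isOpen_lt continuous_const Complex.continuous_re
  have hd : DifferentiableOn ℂ φ {z : ℂ | s.re / 2 < z.re} := by
    refine (h (s.re / 2) (by linarith)).tendstoLocallyUniformlyOn.differentiableOn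
      (Eventually.of_forall fun N => ?_) hopen
    refine DifferentiableOn.fun_sum fun m _ => Differentiable.differentiableOn fun z => ?_
    exact (LSeries.hasDerivAt_term c m z).differentiableAt
  exact (hd.differentiableAt (hopen.mem_nhds (show s.re / 2 < s.re by linarith))).differentiableWithinAt

/-- The image of `ℂ₂` under `2^{-φ}` contains a disc centred in the unit disc. -/
theorem exists_closedBall_subset_image {φ : ℂ → ℂ} (hφ : DifferentiableOn ℂ φ {s : ℂ | 0 < s.re})
    (hnc : ∃ s₁ s₂ : ℂ, 0 < s₁.re ∧ 0 < s₂.re ∧ φ s₁ ≠ φ s₂)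
    (hmap : ∀ s : ℂ, 0 < s.re → 0 < (φ s).re) :
    ∃ (z₀ : ℂ) (ρ : ℝ), ‖z₀‖ ≤ 1 ∧ 0 < ρ ∧ ρ ≤ 1 ∧
      ∀ z : ℂ, ‖z - z₀‖ ≤ ρ → ∃ s : ℂ, 2 < s.re ∧ (2 : ℂ) ^ (-φ s) = z := by
  have hopen : ∀ t : ℝ, IsOpen {z : ℂ | t < z.re} := fun t =>
    isOpen_lt continuous_const Complex.continuous_re
  have himage : IsOpen (φ '' {s : ℂ | 2 < s.re}) := by
    rcases (hφ.analyticOnNhd (hopen 0)).is_constant_or_isOpen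
      (convex_halfSpace_re_gt 0).isPreconnected with ⟨w, hw⟩ | h
    · obtain ⟨s₁, s₂, h₁, h₂, hne⟩ := hnc
      exact absurd ((hw s₁ h₁).trans (hw s₂ h₂).symm) hne
    · exact h _ (fun s (hs : 2 < s.re) => show 0 < s.re by linarith) (hopen 2)
  have hderiv : HasStrictDerivAt (fun w : ℂ => (2 : ℂ) ^ (-w))
      ((2 : ℂ) ^ (-φ 3) * Complex.log 2 * (-1)) (φ 3) :=
    (hasStrictDerivAt_id (φ 3)).neg.const_cpow (Or.inl two_ne_zero)
  have hlog : Complex.log 2 ≠ 0 := by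
    rw [← Complex.ofReal_ofNat, ← Complex.ofReal_log (by norm_num)]
    exact_mod_cast (Real.log_pos one_lt_two).ne'
  have hne : (2 : ℂ) ^ (-φ 3) * Complex.log 2 * (-1) ≠ 0 :=
    mul_ne_zero (mul_ne_zero (by simp [Complex.cpow_eq_zero_iff]) hlog) (by norm_num)
  have hmem : (fun w : ℂ => (2 : ℂ) ^ (-w)) '' (φ '' {s : ℂ | 2 < s.re}) ∈
      nhds ((2 : ℂ) ^ (-φ 3)) := by
    have := image_mem_map (m := fun w : ℂ => (2 : ℂ) ^ (-w))
      (himage.mem_nhds (Set.mem_image_of_mem φ (show (2 : ℝ) < (3 : ℂ).re by norm_num)))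
    rwa [hderiv.map_nhds_eq hne] at this
  obtain ⟨ε, hε, hball⟩ := Metric.nhds_basis_closedBall.mem_iff.mp hmem
  refine ⟨(2 : ℂ) ^ (-φ 3), min ε 1, ?_, lt_min hε one_pos, min_le_right _ _, fun z hz => ?_⟩
  · have h3 : 0 < (φ 3).re := hmap 3 (by norm_num)
    rw [← Nat.cast_ofNat, Complex.norm_natCast_cpow_of_pos (by norm_num)]
    exact Real.rpow_le_one_of_one_le_of_nonpos (by norm_num) (by simpa using h3.le)
  · obtain ⟨_, ⟨s, hs, rfl⟩, hsz⟩ := hball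
      (show z ∈ Metric.closedBall _ ε by
        simpa [dist_eq_norm] using hz.trans (min_le_left _ _))
    exact ⟨s, hs, hsz⟩

theorem stmt2 (φ : ℂ → ℂ) (c : ℕ → ℂ) (hconv : DSConvUnif c φ)
    (hnc : ∃ s₁ s₂ : ℂ, 0 < s₁.re ∧ 0 < s₂.re ∧ φ s₁ ≠ φ s₂)
    (hmap : ∀ s : ℂ, 0 < s.re → 1 / 2 < (φ s).re)
    (T : H2 →L[ℂ] H2) (hT : IsCompOp φ T) (hcpt : IsCompactOperator ⇑T) :
    ∃ C : ℝ, 0 < C ∧ ∃ r ∈ Set.Ioo (0 : ℝ) 1, ∀ n : ℕ, 1 ≤ n →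
      C * r ^ n ≤ approxNumber T n := by
  obtain ⟨z₀, ρ, hz₀, hρ, hρ1, himage⟩ := exists_closedBall_subset_image hconv.differentiableOn hnc
    fun s hs => one_half_pos.trans (hmap s hs)
  obtain ⟨A, hA, hbound⟩ := exists_norm_H2series_le
  refine ⟨1 / A, by positivity, ρ / 8, ⟨by positivity, by linarith⟩, fun n hn => ?_⟩
  refine le_approxNumber T hn (dyadicH2 n) dyadicH2_ne_zero fun a => ?_
  have hsum := Polynomial.sum_norm_coeff_le_of_closedBall (coeffPoly a)
    (natDegree_coeffPoly_lt hn a) hz₀ hρ hρ1 (M := A * ‖T (dyadicH2 n a)‖) fun z hz => by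
      obtain ⟨s, hs, rfl⟩ := himage z hz
      rw [← H2series_dyadicH2, ← hT _ s (by linarith)]
      exact hbound _ s hs
  rw [← Fin.sum_univ_eq_sum_range fun k => ‖(coeffPoly a).coeff k‖] at hsum
  simp only [coeff_coeffPoly] at hsum
  calc 1 / A * (ρ / 8) ^ n * ‖dyadicH2 n a‖
      ≤ 1 / A * (ρ / 8) ^ n * (A * ‖T (dyadicH2 n a)‖ * (8 / ρ) ^ n) := by
        gcongr
        exact (norm_dyadicH2_le a).trans hsum
    _ = ‖T (dyadicH2 n a)‖ := by
        rw [div_pow, div_pow]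
        field_simp
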